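/- Let G be a connected finite simple graph on a finite vertex type V, let m₁, m₂ ∈ V be distinct vertices not adjacent in G, and let G' be the graph obtained from G by adding the edge {m₁, m₂}. Then λ₁(G) = λ₁(G') if and only if there exists a nonzero ψ : V → ℝ with ∑_{v ∈ V} ψ(v) = 0, L(G)ψ = λ₁(G)·ψ, and ψ(m₁) = ψ(m₂). -/

import Mathlib

open Finset Matrix

/-- The spectral gap (algebraic connectivity) of a finite simple graph `G`:
the infimum of the Rayleigh quotient `⟨ψ, L(G)ψ⟩ / ⟨ψ, ψ⟩` over all nonzero
`ψ : V → ℝ` with mean value zero. -/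
noncomputable def lambda1 {V : Type*} [Fintype V] [DecidableEq V] (G : SimpleGraph V) : ℝ :=
  letI : DecidableRel G.Adj := Classical.decRel _
  sInf {r : ℝ | ∃ ψ : V → ℝ, ψ ≠ 0 ∧ (∑ v, ψ v) = 0 ∧
    r = (ψ ⬝ᵥ (G.lapMatrix ℝ *ᵥ ψ)) / (ψ ⬝ᵥ ψ)}

section RayleighQuotient

variable {V : Type*} [Fintype V] [DecidableEq V]

theorem lambda1_eq_sInf (G : SimpleGraph V) [DecidableRel G.Adj] :
    lambda1 G = sInf {r : ℝ | ∃ ψ : V → ℝ, ψ ≠ 0 ∧ (∑ v, ψ v) = 0 ∧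
      r = (ψ ⬝ᵥ (G.lapMatrix ℝ *ᵥ ψ)) / (ψ ⬝ᵥ ψ)} := by
  unfold lambda1
  congr!

omit [DecidableEq V] in
theorem dotProduct_self_pos_of_ne_zero {ψ : V → ℝ} (h : ψ ≠ 0) : 0 < ψ ⬝ᵥ ψ := by
  simpa using Matrix.dotProduct_star_self_pos_iff.mpr h

theorem dotProduct_lapMatrix_mulVec_self (G : SimpleGraph V) [DecidableRel G.Adj] (ψ : V → ℝ) :
    ψ ⬝ᵥ (G.lapMatrix ℝ *ᵥ ψ) =
      (∑ i : V, ∑ j : V, if G.Adj i j then (ψ i - ψ j) ^ 2 else 0) / 2 := by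
  rw [← Matrix.toLinearMap₂'_apply', SimpleGraph.lapMatrix_toLinearMap₂']

theorem dotProduct_lapMatrix_mulVec_self_nonneg (G : SimpleGraph V) [DecidableRel G.Adj]
    (ψ : V → ℝ) : 0 ≤ ψ ⬝ᵥ (G.lapMatrix ℝ *ᵥ ψ) := by
  simpa using (SimpleGraph.posSemidef_lapMatrix ℝ G).dotProduct_mulVec_nonneg ψ

theorem lambda1_mul_le (G : SimpleGraph V) [DecidableRel G.Adj] {ψ : V → ℝ}
    (hsum : ∑ v, ψ v = 0) :
    lambda1 G * (ψ ⬝ᵥ ψ) ≤ ψ ⬝ᵥ (G.lapMatrix ℝ *ᵥ ψ) := by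
  rcases eq_or_ne ψ 0 with rfl | h0
  · simp
  rw [← le_div_iff₀ (dotProduct_self_pos_of_ne_zero h0), lambda1_eq_sInf G]
  refine csInf_le ⟨0, ?_⟩ ⟨ψ, h0, hsum, rfl⟩
  rintro _ ⟨φ, hφ, -, rfl⟩
  exact div_nonneg (dotProduct_lapMatrix_mulVec_self_nonneg G φ)
    (dotProduct_self_pos_of_ne_zero hφ).le

omit [DecidableEq V] in
theorem isCompact_unit_sum_zero :
    IsCompact {ψ : V → ℝ | ∑ v, ψ v = 0 ∧ ψ ⬝ᵥ ψ = 1} := by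
  refine Metric.isCompact_of_isClosed_isBounded ?_ ?_
  · refine IsClosed.inter (isClosed_eq (by fun_prop) continuous_const)
      (isClosed_eq ?_ continuous_const)
    exact continuous_id.dotProduct continuous_id
  · refine (Metric.isBounded_closedBall (x := (0 : V → ℝ)) (r := 1)).subset ?_
    rintro ψ ⟨-, h⟩
    rw [mem_closedBall_zero_iff, pi_norm_le_iff_of_nonneg zero_le_one]
    intro v
    rw [Real.norm_eq_abs, ← sq_le_one_iff_abs_le_one, ← h, dotProduct, sq]
    exact Finset.single_le_sum (f := fun i ↦ ψ i * ψ i)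
      (fun i _ ↦ mul_self_nonneg _) (Finset.mem_univ v)

omit [DecidableEq V] in
theorem inv_sqrt_smul_mem_unit_sum_zero {φ : V → ℝ} (h0 : φ ≠ 0) (hsum : ∑ v, φ v = 0) :
    (√(φ ⬝ᵥ φ))⁻¹ • φ ∈ {ψ : V → ℝ | ∑ v, ψ v = 0 ∧ ψ ⬝ᵥ ψ = 1} := by
  have hpos := dotProduct_self_pos_of_ne_zero h0
  refine ⟨by simp [← Finset.mul_sum, hsum], ?_⟩
  rw [smul_dotProduct, dotProduct_smul, smul_eq_mul, smul_eq_mul, ← mul_assoc, ← mul_inv,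
    Real.mul_self_sqrt hpos.le, inv_mul_cancel₀ hpos.ne']

theorem nonempty_unit_sum_zero [Nontrivial V] :
    {ψ : V → ℝ | ∑ v, ψ v = 0 ∧ ψ ⬝ᵥ ψ = 1}.Nonempty := by
  obtain ⟨a, b, hab⟩ := exists_pair_ne V
  refine ⟨_, inv_sqrt_smul_mem_unit_sum_zero (φ := Pi.single a 1 - Pi.single b 1)
    (fun h ↦ ?_) (by simp)⟩
  simpa [hab] using congrFun h a

/-- The infimum defining the spectral gap is attained. -/
theorem exists_rayleigh_eq_lambda1 [Nontrivial V] (G : SimpleGraph V) [DecidableRel G.Adj] :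
    ∃ ψ : V → ℝ, ψ ≠ 0 ∧ ∑ v, ψ v = 0 ∧
      ψ ⬝ᵥ (G.lapMatrix ℝ *ᵥ ψ) = lambda1 G * (ψ ⬝ᵥ ψ) := by
  have hcont : Continuous fun ψ : V → ℝ ↦ ψ ⬝ᵥ (G.lapMatrix ℝ *ᵥ ψ) :=
    continuous_id.dotProduct (continuous_const.matrix_mulVec continuous_id)
  obtain ⟨ψ, ⟨hsum, hunit⟩, hmin⟩ :=
    isCompact_unit_sum_zero.exists_isMinOn nonempty_unit_sum_zero hcont.continuousOn
  have h0 : ψ ≠ 0 := by rintro rfl; simp at hunit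
  refine ⟨ψ, h0, hsum, le_antisymm ?_ (lambda1_mul_le G hsum)⟩
  rw [hunit, mul_one, lambda1_eq_sInf G]
  refine le_csInf ⟨_, ψ, h0, hsum, rfl⟩ ?_
  rintro _ ⟨φ, hφ, hφsum, rfl⟩
  have hpos := dotProduct_self_pos_of_ne_zero hφ
  have hle : ψ ⬝ᵥ (G.lapMatrix ℝ *ᵥ ψ) ≤
      ((√(φ ⬝ᵥ φ))⁻¹ • φ) ⬝ᵥ (G.lapMatrix ℝ *ᵥ ((√(φ ⬝ᵥ φ))⁻¹ • φ)) :=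
    hmin (inv_sqrt_smul_mem_unit_sum_zero hφ hφsum)
  rwa [mulVec_smul, smul_dotProduct, dotProduct_smul, smul_eq_mul, smul_eq_mul, ← mul_assoc,
    ← mul_inv, Real.mul_self_sqrt hpos.le, ← div_eq_inv_mul] at hle

theorem sum_lapMatrix_mulVec (G : SimpleGraph V) [DecidableRel G.Adj] (ψ : V → ℝ) :
    ∑ v, (G.lapMatrix ℝ *ᵥ ψ) v = 0 := by
  have h : (fun _ ↦ 1) ⬝ᵥ (G.lapMatrix ℝ *ᵥ ψ) = 0 := by
    rw [dotProduct_mulVec, ← mulVec_transpose, G.isSymm_lapMatrix (R := ℝ),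
      SimpleGraph.lapMatrix_mulVec_const_eq_zero, zero_dotProduct]
  simpa [dotProduct] using h

/-- A mean-zero function attaining the spectral gap as Rayleigh quotient is an eigenfunction. -/
theorem lapMatrix_mulVec_eq_of_rayleigh_eq (G : SimpleGraph V) [DecidableRel G.Adj] {ψ : V → ℝ}
    (hsum : ∑ v, ψ v = 0)
    (hψ : ψ ⬝ᵥ (G.lapMatrix ℝ *ᵥ ψ) = lambda1 G * (ψ ⬝ᵥ ψ)) :
    G.lapMatrix ℝ *ᵥ ψ = lambda1 G • ψ := by
  set φ : V → ℝ := G.lapMatrix ℝ *ᵥ ψ - lambda1 G • ψ with hφ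
  have hφsum : ∑ v, φ v = 0 := by
    simp [hφ, sum_lapMatrix_mulVec, ← Finset.mul_sum, hsum]
  have hsymm : ψ ⬝ᵥ (G.lapMatrix ℝ *ᵥ φ) = φ ⬝ᵥ (G.lapMatrix ℝ *ᵥ ψ) := by
    rw [dotProduct_mulVec, ← mulVec_transpose, G.isSymm_lapMatrix (R := ℝ), dotProduct_comm]
  have hself : φ ⬝ᵥ φ = φ ⬝ᵥ (G.lapMatrix ℝ *ᵥ ψ) - lambda1 G * (φ ⬝ᵥ ψ) := by
    conv_lhs => rw [hφ, dotProduct_sub, dotProduct_smul, smul_eq_mul, ← hφ]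
  have hvar (t : ℝ) : 0 ≤ 2 * t * (φ ⬝ᵥ φ) +
      t ^ 2 * (φ ⬝ᵥ (G.lapMatrix ℝ *ᵥ φ) - lambda1 G * (φ ⬝ᵥ φ)) := by
    have h := lambda1_mul_le G (ψ := ψ + t • φ)
      (by simp [Finset.sum_add_distrib, ← Finset.mul_sum, hsum, hφsum])
    simp only [mulVec_add, mulVec_smul, add_dotProduct, dotProduct_add, smul_dotProduct,
      dotProduct_smul, smul_eq_mul, hsymm, hψ, dotProduct_comm ψ φ] at h
    linear_combination h - 2 * t * hself
  have hb := sub_nonneg.mpr (lambda1_mul_le G hφsum)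
  set b := φ ⬝ᵥ (G.lapMatrix ℝ *ᵥ φ) - lambda1 G * (φ ⬝ᵥ φ)
  by_contra hne
  have hpos := dotProduct_self_pos_of_ne_zero (sub_ne_zero.mpr hne)
  rw [← hφ] at hpos
  have h := hvar (-((φ ⬝ᵥ φ) / (b + 1)))
  have hb' : 0 < b + 1 := by linarith
  have heq : 2 * -((φ ⬝ᵥ φ) / (b + 1)) * (φ ⬝ᵥ φ) + (-((φ ⬝ᵥ φ) / (b + 1))) ^ 2 * b =
      -((φ ⬝ᵥ φ) ^ 2 * (b + 2) / (b + 1) ^ 2) := by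
    field_simp
    ring
  have : 0 < (φ ⬝ᵥ φ) ^ 2 * (b + 2) / (b + 1) ^ 2 := by positivity
  linarith

theorem dotProduct_lapMatrix_sup_edge (G : SimpleGraph V) [DecidableRel G.Adj] {m₁ m₂ : V}
    [DecidableRel (G ⊔ SimpleGraph.edge m₁ m₂).Adj] (hne : m₁ ≠ m₂) (hadj : ¬ G.Adj m₁ m₂)
    (ψ : V → ℝ) :
    ψ ⬝ᵥ ((G ⊔ SimpleGraph.edge m₁ m₂).lapMatrix ℝ *ᵥ ψ) =
      ψ ⬝ᵥ (G.lapMatrix ℝ *ᵥ ψ) + (ψ m₁ - ψ m₂) ^ 2 := by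
  have hterm (i j : V) :
      (if (G ⊔ SimpleGraph.edge m₁ m₂).Adj i j then (ψ i - ψ j) ^ 2 else 0) =
        (if G.Adj i j then (ψ i - ψ j) ^ 2 else 0) +
        ((if i = m₁ then if j = m₂ then (ψ m₁ - ψ m₂) ^ 2 else 0 else 0) +
        (if i = m₂ then if j = m₁ then (ψ m₁ - ψ m₂) ^ 2 else 0 else 0)) := by
    have hadj' : ¬ G.Adj m₂ m₁ := fun h ↦ hadj h.symm
    simp only [SimpleGraph.sup_adj, SimpleGraph.edge_adj]
    split_ifs <;> grind
  rw [dotProduct_lapMatrix_mulVec_self, dotProduct_lapMatrix_mulVec_self]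
  simp only [hterm, Finset.sum_add_distrib]
  simp
  ring

end RayleighQuotient

theorem spectral_gap_eq_iff_eigenfunction_equal_values
    {V : Type*} [Fintype V] [DecidableEq V]
    (G : SimpleGraph V) [DecidableRel G.Adj] (hconn : G.Connected)
    (m₁ m₂ : V) (hne : m₁ ≠ m₂) (hadj : ¬ G.Adj m₁ m₂) :
    lambda1 G = lambda1 (G ⊔ SimpleGraph.edge m₁ m₂) ↔
      ∃ ψ : V → ℝ, ψ ≠ 0 ∧ (∑ v, ψ v) = 0 ∧
        G.lapMatrix ℝ *ᵥ ψ = lambda1 G • ψ ∧ ψ m₁ = ψ m₂ := by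
  classical
  have : Nontrivial V := ⟨m₁, m₂, hne⟩
  obtain ⟨φ, hφ, hφsum, hφeq⟩ := exists_rayleigh_eq_lambda1 (G ⊔ SimpleGraph.edge m₁ m₂)
  have hφG := lambda1_mul_le G hφsum
  rw [dotProduct_lapMatrix_sup_edge G hne hadj] at hφeq
  constructor
  · intro h
    rw [← h] at hφeq
    have hsq : (φ m₁ - φ m₂) ^ 2 = 0 := le_antisymm (by linarith) (sq_nonneg _)
    exact ⟨φ, hφ, hφsum, lapMatrix_mulVec_eq_of_rayleigh_eq G hφsum (by linarith),
      sub_eq_zero.mp (pow_eq_zero_iff two_ne_zero |>.mp hsq)⟩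
  · rintro ⟨ψ, hψ, hψsum, hψeq, hval⟩
    refine le_antisymm ?_ ?_
    · refine le_of_mul_le_mul_right ?_ (dotProduct_self_pos_of_ne_zero hφ)
      linarith [sq_nonneg (φ m₁ - φ m₂)]
    · refine le_of_mul_le_mul_right ?_ (dotProduct_self_pos_of_ne_zero hψ)
      have h := lambda1_mul_le (G ⊔ SimpleGraph.edge m₁ m₂) hψsum
      rw [dotProduct_lapMatrix_sup_edge G hne hadj, hψeq, hval, sub_self] at h
      simpa using h
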